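/- For every a ∈ [0,2], the set K_a = {x ∈ [0,1] : the frequencies ν_0(x), ν_1(x), ν_2(x) all exist and ν_1(x) + 2·ν_2(x) = a} has the cardinality of the continuum. -/

import Mathlib

open Filter

/-- The `n`-th ternary digit of `x`: `⌊3^n x⌋ mod 3`. -/
noncomputable def ternDigit (x : ℝ) (n : ℕ) : ℤ := ⌊(3 : ℝ) ^ n * x⌋ % 3

/-- `N_i(x,k)`: the number of indices `1 ≤ n ≤ k` with `α_n(x) = i`. -/
noncomputable def digitCount (i : ℤ) (x : ℝ) (k : ℕ) : ℕ :=
  ((Finset.Icc 1 k).filter (fun n => ternDigit x n = i)).card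

/-- The frequency `ν_i(x)` exists and equals `v`. -/
def hasFreq (i : ℤ) (x : ℝ) (v : ℝ) : Prop :=
  Tendsto (fun k : ℕ => (digitCount i x k : ℝ) / k) atTop (nhds v)

/-- The asymptotic mean of digits `r(x)` exists and equals `r`. -/
def hasMean (x : ℝ) (r : ℝ) : Prop :=
  Tendsto (fun n : ℕ => (1 / (n : ℝ)) * ∑ k ∈ Finset.Icc 1 n, (ternDigit x k : ℝ))
    atTop (nhds r)

theorem three_mul_ofDigits (d : ℕ → Fin 3) :
    3 * Real.ofDigits d = (d 0 : ℕ) + Real.ofDigits (fun i => d (i + 1)) := by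
  rw [Real.ofDigits_eq_sum_add_ofDigits d 1]
  simp [Real.ofDigitsTerm]
  ring

theorem ofDigits_lt_one_of_ne_two (d : ℕ → Fin 3) (i : ℕ) (h : d i ≠ 2) :
    Real.ofDigits d < 1 := by
  induction i generalizing d with
  | zero =>
    have h0 : ((d 0 : ℕ) : ℝ) ≤ 1 := by
      have : (d 0 : ℕ) ≤ 1 := by omega
      exact_mod_cast this
    linarith [three_mul_ofDigits d, Real.ofDigits_le_one (fun i => d (i + 1))]
  | succ i ih =>
    have h0 : ((d 0 : ℕ) : ℝ) ≤ 2 := by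
      have : (d 0 : ℕ) ≤ 2 := by omega
      exact_mod_cast this
    linarith [three_mul_ofDigits d, ih (fun i => d (i + 1)) h]

theorem exists_int_pow_mul_ofDigits (d : ℕ → Fin 3) (n : ℕ) :
    ∃ A : ℤ, 3 ^ n * Real.ofDigits d = A + Real.ofDigits (fun i => d (i + n)) := by
  induction n with
  | zero => exact ⟨0, by simp⟩
  | succ n ih =>
    obtain ⟨A, hA⟩ := ih
    refine ⟨3 * A + (d n : ℕ), ?_⟩
    have h := three_mul_ofDigits (fun i => d (i + n))
    have h' : (fun i => d (i + 1 + n)) = fun i => d (i + (n + 1)) := by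
      funext i
      congr 1
      omega
    rw [h', zero_add] at h
    push_cast
    rw [pow_succ]
    linarith

/-- A digit sequence not ending in the period `(2)` is the ternary representation of its sum. -/
theorem ternDigit_ofDigits (d : ℕ → Fin 3) (hd : ∀ n, ∃ i, d (i + n) ≠ 2) (n : ℕ) :
    ternDigit (Real.ofDigits d) (n + 1) = ((d n : ℕ) : ℤ) := by
  obtain ⟨A, hA⟩ := exists_int_pow_mul_ofDigits d n
  have h := three_mul_ofDigits (fun i => d (i + n))
  obtain ⟨i, hi⟩ := hd (n + 1)
  have hi' : (fun i => d (i + 1 + n)) i ≠ 2 := by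
    convert hi using 2
    omega
  have hlt := ofDigits_lt_one_of_ne_two (fun i => d (i + 1 + n)) i hi'
  have hnn := Real.ofDigits_nonneg (fun i => d (i + 1 + n))
  have hfl : ⌊(3 : ℝ) ^ (n + 1) * Real.ofDigits d⌋ = 3 * A + (d n : ℕ) := by
    rw [Int.floor_eq_iff, pow_succ]
    rw [zero_add] at h
    push_cast
    constructor <;> linarith
  have := (d n).isLt
  rw [ternDigit, hfl]
  omega

/-- Ternary digits with value `2` at density `c`, except at the perfect squares,
where the bits `b` are written. -/
noncomputable def squareCodedDigits (c : ℝ) (b : ℕ → Bool) (i : ℕ) : Fin 3 :=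
  if IsSquare (i + 1) then (if b (Nat.sqrt (i + 1)) then 1 else 0)
  else if ⌊c * ((i + 1 : ℕ) : ℝ)⌋₊ = ⌊c * (i : ℝ)⌋₊ then 0 else 2

theorem squareCodedDigits_sq (c : ℝ) (b : ℕ → Bool) (m i : ℕ) (hi : i + 1 = m * m) :
    squareCodedDigits c b i = if b m then 1 else 0 := by
  rw [squareCodedDigits, hi, if_pos ⟨m, rfl⟩, Nat.sqrt_eq]

theorem exists_squareCodedDigits_ne_two (c : ℝ) (b : ℕ → Bool) (n : ℕ) :
    ∃ i, squareCodedDigits c b (i + n) ≠ 2 := by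
  have hle : n + 1 ≤ (n + 1) * (n + 1) := Nat.le_mul_self _
  refine ⟨(n + 1) * (n + 1) - 1 - n, ?_⟩
  rw [squareCodedDigits_sq c b (n + 1) _ (by omega)]
  split_ifs <;> decide

theorem ternDigit_squareCodedDigits (c : ℝ) (b : ℕ → Bool) (n : ℕ) :
    ternDigit (Real.ofDigits (squareCodedDigits c b)) (n + 1) =
      ((squareCodedDigits c b n : ℕ) : ℤ) :=
  ternDigit_ofDigits _ (exists_squareCodedDigits_ne_two c b) n

theorem ofDigits_squareCodedDigits_injective (c : ℝ) :
    Function.Injective fun b : ℕ → Bool =>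
      Real.ofDigits (squareCodedDigits c fun n => b (n - 1)) := by
  intro b b' h
  funext m
  have hpos : 0 < (m + 1) * (m + 1) := by positivity
  obtain ⟨i, hi⟩ : ∃ i, i + 1 = (m + 1) * (m + 1) := ⟨(m + 1) * (m + 1) - 1, by omega⟩
  have h1 := ternDigit_squareCodedDigits c (fun n => b (n - 1)) i
  have h2 := ternDigit_squareCodedDigits c (fun n => b' (n - 1)) i
  simp only at h
  rw [h, h2, squareCodedDigits_sq _ _ _ _ hi, squareCodedDigits_sq _ _ _ _ hi] at h1
  cases hb : b m <;> cases hb' : b' m <;> simp_all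

theorem digitCount_succ (i : ℤ) (x : ℝ) (k : ℕ) :
    digitCount i x (k + 1) = digitCount i x k + if ternDigit x (k + 1) = i then 1 else 0 := by
  rw [digitCount, ← Finset.insert_Icc_right_eq_Icc_add_one (by omega), Finset.filter_insert]
  split_ifs
  · rw [Finset.card_insert_of_notMem (by simp), digitCount]
  · rfl

theorem digitCount_sum (x : ℝ) (k : ℕ) :
    digitCount 0 x k + digitCount 1 x k + digitCount 2 x k = k := by
  induction k with
  | zero => simp [digitCount]
  | succ k ih =>
    simp only [digitCount_succ]
    have : ternDigit x (k + 1) = 0 ∨ ternDigit x (k + 1) = 1 ∨ ternDigit x (k + 1) = 2 := by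
      unfold ternDigit
      omega
    rcases this with h | h | h <;> simp [h] <;> omega

theorem sqrt_succ_of_isSquare {k : ℕ} (h : IsSquare (k + 1)) :
    Nat.sqrt k + 1 ≤ Nat.sqrt (k + 1) := by
  obtain ⟨r, hr⟩ := h
  rw [hr, Nat.sqrt_eq, Nat.add_one_le_iff, Nat.sqrt_lt]
  omega

theorem floor_mul_succ_le {c : ℝ} (hc : c ∈ Set.Icc (0 : ℝ) 1) (k : ℕ) :
    ⌊c * ((k + 1 : ℕ) : ℝ)⌋₊ ≤ ⌊c * (k : ℝ)⌋₊ + 1 := by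
  have h0 : 0 ≤ c * (k : ℝ) := mul_nonneg hc.1 (Nat.cast_nonneg k)
  rw [← Nat.floor_add_one h0]
  apply Nat.floor_le_floor
  push_cast
  linarith [hc.2]

theorem floor_mul_le_succ {c : ℝ} (hc : c ∈ Set.Icc (0 : ℝ) 1) (k : ℕ) :
    ⌊c * (k : ℝ)⌋₊ ≤ ⌊c * ((k + 1 : ℕ) : ℝ)⌋₊ := by
  apply Nat.floor_le_floor
  push_cast
  linarith [hc.1]

theorem digitCount_squareCodedDigits {c : ℝ} (hc : c ∈ Set.Icc (0 : ℝ) 1) (b : ℕ → Bool) (k : ℕ) :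
    digitCount 1 (Real.ofDigits (squareCodedDigits c b)) k ≤ Nat.sqrt k ∧
    digitCount 2 (Real.ofDigits (squareCodedDigits c b)) k ≤ ⌊c * (k : ℝ)⌋₊ ∧
    ⌊c * (k : ℝ)⌋₊ ≤
      digitCount 2 (Real.ofDigits (squareCodedDigits c b)) k + Nat.sqrt k := by
  induction k with
  | zero => simp [digitCount]
  | succ k ih =>
    simp only [digitCount_succ, ternDigit_squareCodedDigits]
    have h1 := floor_mul_succ_le hc k
    have h2 := floor_mul_le_succ hc k
    have h3 : Nat.sqrt k ≤ Nat.sqrt (k + 1) := Nat.sqrt_le_sqrt (Nat.le_succ k)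
    by_cases hs : IsSquare (k + 1)
    · have h4 := sqrt_succ_of_isSquare hs
      cases hb : b (Nat.sqrt (k + 1)) <;> simp [squareCodedDigits, hs, hb] at * <;> omega
    · by_cases he : ⌊c * ((k + 1 : ℕ) : ℝ)⌋₊ = ⌊c * (k : ℝ)⌋₊
      · have hv : squareCodedDigits c b k = 0 := by rw [squareCodedDigits, if_neg hs, if_pos he]
        simp only [hv]
        norm_num at *
        omega
      · have hv : squareCodedDigits c b k = 2 := by rw [squareCodedDigits, if_neg hs, if_neg he]
        simp only [hv]
        norm_num at *
        omega

theorem tendsto_natSqrt_div_atTop :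
    Tendsto (fun k : ℕ => (Nat.sqrt k : ℝ) / k) atTop (nhds 0) := by
  have h : Tendsto (fun k : ℕ => (√(k : ℝ))⁻¹) atTop (nhds 0) :=
    tendsto_inv_atTop_zero.comp (Real.tendsto_sqrt_atTop.comp tendsto_natCast_atTop_atTop)
  refine squeeze_zero (fun k => by positivity) (fun k => ?_) h
  rw [← Real.sqrt_div_self]
  gcongr
  exact Real.nat_sqrt_le_real_sqrt

theorem hasFreq_one_squareCodedDigits {c : ℝ} (hc : c ∈ Set.Icc (0 : ℝ) 1) (b : ℕ → Bool) :
    hasFreq 1 (Real.ofDigits (squareCodedDigits c b)) 0 := by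
  refine squeeze_zero (fun k => by positivity) (fun k => ?_) tendsto_natSqrt_div_atTop
  gcongr
  exact (digitCount_squareCodedDigits hc b k).1

theorem hasFreq_two_squareCodedDigits {c : ℝ} (hc : c ∈ Set.Icc (0 : ℝ) 1) (b : ℕ → Bool) :
    hasFreq 2 (Real.ofDigits (squareCodedDigits c b)) c := by
  have hf : Tendsto (fun k : ℕ => (⌊c * (k : ℝ)⌋₊ : ℝ) / k) atTop (nhds c) :=
    (tendsto_nat_floor_mul_div_atTop hc.1).comp tendsto_natCast_atTop_atTop
  have hl := hf.sub tendsto_natSqrt_div_atTop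
  rw [sub_zero] at hl
  refine tendsto_of_tendsto_of_tendsto_of_le_of_le hl hf (fun k => ?_) fun k => ?_
  · have h := (digitCount_squareCodedDigits hc b k).2.2
    rify at h
    simp only [← sub_div]
    gcongr
    linarith
  · simp only
    gcongr
    exact (digitCount_squareCodedDigits hc b k).2.1

theorem hasFreq_zero_of_hasFreq {x v w : ℝ} (h1 : hasFreq 1 x v) (h2 : hasFreq 2 x w) :
    hasFreq 0 x (1 - v - w) := by
  refine Tendsto.congr' ?_ ((tendsto_const_nhds.sub h1).sub h2)
  filter_upwards [eventually_gt_atTop 0] with k hk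
  have h := digitCount_sum x k
  rify at h hk
  field_simp
  linarith

/-- For every `a ∈ [0,2]`, the set `K_a` of numbers in `[0,1]` whose three
ternary digit frequencies exist and satisfy `ν_1 + 2ν_2 = a` has the
cardinality of the continuum. -/
theorem K_a_continuum (a : ℝ) (ha : a ∈ Set.Icc (0 : ℝ) 2) :
    Cardinal.mk ↥{x ∈ Set.Icc (0 : ℝ) 1 |
      ∃ v0 v1 v2 : ℝ, hasFreq 0 x v0 ∧ hasFreq 1 x v1 ∧ hasFreq 2 x v2 ∧
        v1 + 2 * v2 = a} = Cardinal.continuum := by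
  obtain ⟨ha0, ha2⟩ := ha
  have hc : a / 2 ∈ Set.Icc (0 : ℝ) 1 := ⟨by linarith, by linarith⟩
  apply le_antisymm
  · exact (Cardinal.mk_set_le _).trans Cardinal.mk_real.le
  · have hinj := ofDigits_squareCodedDigits_injective (a / 2)
    have hle := Cardinal.mk_le_of_injective (hinj.codRestrict (s := {x ∈ Set.Icc (0 : ℝ) 1 |
      ∃ v0 v1 v2 : ℝ, hasFreq 0 x v0 ∧ hasFreq 1 x v1 ∧ hasFreq 2 x v2 ∧
        v1 + 2 * v2 = a}) fun b => ?_)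
    · simpa using hle
    · have h1 := hasFreq_one_squareCodedDigits hc fun n => b (n - 1)
      have h2 := hasFreq_two_squareCodedDigits hc fun n => b (n - 1)
      exact ⟨⟨Real.ofDigits_nonneg _, Real.ofDigits_le_one _⟩, _, _, _,
        hasFreq_zero_of_hasFreq h1 h2, h1, h2, by ring⟩
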